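/- Let (F_n) denote the Fibonacci sequence with F_1 = F_2 = 1. For every n ≥ 1, the integer 5·F_n divides F_{5n}, and the quotient F_{5n}/(5·F_n) is congruent to 1 modulo 10 (i.e., its unit digit in base ten is 1). -/

import Mathlib

theorem fib_cassini_aux (m : ℕ) :
    ((Nat.fib m : ℤ) ^ 2 + Nat.fib m * Nat.fib (m + 1) - (Nat.fib (m + 1) : ℤ) ^ 2) ^ 2 = 1 := by
  induction m with
  | zero => simp
  | succ k ih =>
    rw [Nat.fib_add_two]
    push_cast
    linear_combination ih

theorem fib_five_mul_aux (m : ℕ) :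
    Nat.fib (5 * (m + 1)) =
      (Nat.fib (2 * m + 2) * (2 * Nat.fib (2 * m + 1) + Nat.fib (2 * m + 2))) * Nat.fib m +
      (Nat.fib (2 * m + 2) ^ 2 + Nat.fib (2 * m + 1) ^ 2 +
        Nat.fib (2 * m + 2) * (2 * Nat.fib (2 * m + 1) + Nat.fib (2 * m + 2))) *
        Nat.fib (m + 1) := by
  have h1 := Nat.fib_two_mul_add_one (2 * m + 1)
  have h2 := Nat.fib_two_mul_add_two (2 * m + 1)
  have h3 := Nat.fib_add_two (n := 2 * (2 * m + 1) + 1)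
  have h4 := Nat.fib_add (2 * (2 * m + 1) + 2) m
  have e : 5 * (m + 1) = 2 * (2 * m + 1) + 2 + m + 1 := by ring
  rw [e, h4, h3, h2, h1]

/-- For every `n ≥ 1`, the integer `5·F_n` divides `F_{5n}`, and the quotient
`F_{5n}/(5·F_n)` has unit digit `1` in base ten. -/
theorem fib_five_mul_div_unit_digit (n : ℕ) (hn : 1 ≤ n) :
    (5 * Nat.fib n) ∣ Nat.fib (5 * n) ∧ (Nat.fib (5 * n) / (5 * Nat.fib n)) % 10 = 1 := by
  obtain ⟨m, rfl⟩ : ∃ m, n = m + 1 := ⟨n - 1, by omega⟩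
  have hb : 0 < Nat.fib (m + 1) := Nat.fib_pos.2 (by omega)
  have hF := fib_five_mul_aux m
  rw [Nat.fib_two_mul_add_one, Nat.fib_two_mul_add_two] at hF
  have hc := fib_cassini_aux m
  generalize Nat.fib (5 * (m + 1)) = N at *
  generalize Nat.fib (m + 1) = b at *
  generalize Nat.fib m = a at *
  obtain ⟨e, he⟩ : ∃ e : ℤ, (a : ℤ) ^ 2 + a * b - (b : ℤ) ^ 2 = e := ⟨_, rfl⟩
  rw [he] at hc
  have hN : (N : ℤ) = 5 * b * (5 * (b ^ 2 * (b ^ 2 + e)) + 1) := by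
    rw [hF, ← hc, ← he]
    push_cast
    ring
  have he' : e = 1 ∨ e = -1 := by simpa using hc
  have hev : ∃ k : ℕ, (b : ℤ) ^ 2 * (b ^ 2 + e) = 2 * k := by
    have hb1 : (1 : ℤ) ≤ b := by exact_mod_cast hb
    have hnn : 0 ≤ (b : ℤ) ^ 2 * (b ^ 2 + e) := by
      have : 0 ≤ (b : ℤ) ^ 2 + e := by rcases he' with h | h <;> nlinarith
      positivity
    have h2 : (2 : ℤ) ∣ (b : ℤ) ^ 2 * (b ^ 2 + e) := by
      rw [← even_iff_two_dvd]
      generalize (b : ℤ) ^ 2 = t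
      rcases he' with h | h <;> subst h <;> rw [Int.even_mul, Int.even_add] <;> simp [Int.even_or_odd]
    obtain ⟨k, hk⟩ := h2
    exact ⟨k.toNat, by omega⟩
  obtain ⟨k, hk⟩ := hev
  rw [hk] at hN
  have hN' : N = 5 * b * (10 * k + 1) := by
    zify
    rw [hN]
    ring
  refine ⟨⟨_, hN'⟩, ?_⟩
  rw [hN', Nat.mul_div_cancel_left _ (by omega)]
  omega
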